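/- Let ε with 0 < ε < 1/2 and let F be a finite family of finite sets with |F| ≥ 2 that is (1−ε)-approximate union closed. Then there exists an element x that is contained in at least a (ψ − δ) fraction of the sets of F, where ψ = (3−√5)/2 and δ = 2ε(1 + log₂(1/ε)/log₂|F|). -/

import Mathlib

/-- A finite family `F` is `c`-approximate union closed if at least a `c`-fraction of the
ordered pairs `(A, B) ∈ F × F` satisfy `A ∪ B ∈ F`. -/
def ApproxUnionClosed {α : Type*} [DecidableEq α] (F : Finset (Finset α)) (c : ℝ) : Prop :=
  ((((F ×ˢ F).filter fun p => p.1 ∪ p.2 ∈ F).card : ℝ)) ≥ c * ((F.card : ℝ) * (F.card : ℝ))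

theorem cubic_no_three_pos_roots {c u v w : ℝ} (hc0 : 0 < c) (hc1 : c < 1) (hu : 0 < u)
    (huv : u < v) (hvw : v < w)
    (h1 : (1 + c) * (2 + 3 * u - u ^ 3) - 4 - 4 * u ^ 2 = 0)
    (h2 : (1 + c) * (2 + 3 * v - v ^ 3) - 4 - 4 * v ^ 2 = 0)
    (h3 : (1 + c) * (2 + 3 * w - w ^ 3) - 4 - 4 * w ^ 2 = 0) : False := by
  have e1 : (1 + c) * (3 - (u ^ 2 + u * v + v ^ 2)) - 4 * (u + v) = 0 := by
    have : (v - u) * ((1 + c) * (3 - (u ^ 2 + u * v + v ^ 2)) - 4 * (u + v)) = 0 := by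
      linear_combination h2 - h1
    exact (mul_eq_zero.mp this).resolve_left (by linarith)
  have e2 : (1 + c) * (3 - (v ^ 2 + v * w + w ^ 2)) - 4 * (v + w) = 0 := by
    have : (w - v) * ((1 + c) * (3 - (v ^ 2 + v * w + w ^ 2)) - 4 * (v + w)) = 0 := by
      linear_combination h3 - h2
    exact (mul_eq_zero.mp this).resolve_left (by linarith)
  have e3 : (1 + c) * (u + v + w) + 4 = 0 := by
    have : (w - u) * ((1 + c) * (u + v + w) + 4) = 0 := by
      linear_combination e1 - e2
    exact (mul_eq_zero.mp this).resolve_left (by linarith)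
  have : 0 < (1 + c) * (u + v + w) := by
    apply mul_pos <;> linarith
  linarith

/-- With `c = (√5 - 1) / 2`, this is `h (x ^ 2) - (1 + c) * x * h x` for the binary entropy `h`. -/
noncomputable def entropyGap (c x : ℝ) : ℝ :=
  -(1 - c) * x ^ 2 * Real.log x - (1 - x) * (1 - c * x) * Real.log (1 - x)
    - (1 - x ^ 2) * Real.log (1 + x)

/-- The first derivative of `entropyGap`. -/
noncomputable def entropyGapDeriv (c x : ℝ) : ℝ :=
  -2 * (1 - c) * (x * Real.log x) + (1 + c - 2 * c * x) * Real.log (1 - x)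
    + 2 * x * Real.log (1 + x)

/-- The second derivative of `entropyGap`. -/
noncomputable def entropyGapDerivTwo (c x : ℝ) : ℝ :=
  -2 * (1 - c) * (Real.log x + 1) - 2 * c * Real.log (1 - x) - (1 + c - 2 * c * x) / (1 - x)
    + 2 * Real.log (1 + x) + 2 * x / (1 + x)

theorem hasDerivAt_log_one_sub {x : ℝ} (hx : x < 1) :
    HasDerivAt (fun x : ℝ => Real.log (1 - x)) (-1 / (1 - x)) x :=
  ((hasDerivAt_id x).const_sub 1).log (by simp only [id]; linarith)

theorem hasDerivAt_log_one_add {x : ℝ} (hx : 0 < x) :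
    HasDerivAt (fun x : ℝ => Real.log (1 + x)) (1 / (1 + x)) x :=
  ((hasDerivAt_id x).const_add 1).log (by simp only [id]; linarith)

theorem hasDerivAt_entropyGap (c : ℝ) {x : ℝ} (hx0 : 0 < x) (hx1 : x < 1) :
    HasDerivAt (entropyGap c) (entropyGapDeriv c x) x := by
  have hx : HasDerivAt (fun x : ℝ => x) 1 x := hasDerivAt_id x
  have h1 := Real.hasDerivAt_log hx0.ne'
  have h2 := hasDerivAt_log_one_sub hx1
  have h3 := hasDerivAt_log_one_add hx0
  have := ((((hx.pow 2).const_mul (-(1 - c))).mul h1).sub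
    (((hx.const_sub 1).mul ((hx.const_mul c).const_sub 1)).mul h2)).sub
    (((hx.pow 2).const_sub 1).mul h3)
  refine this.congr_deriv ?_
  have a1 : 1 - x ≠ 0 := by linarith
  have a2 : 1 + x ≠ 0 := by linarith
  have a3 := hx0.ne'
  simp only [entropyGapDeriv, Pi.mul_apply, Pi.pow_apply]
  field_simp
  push_cast
  ring

theorem hasDerivAt_entropyGapDeriv (c : ℝ) {x : ℝ} (hx0 : 0 < x) (hx1 : x < 1) :
    HasDerivAt (entropyGapDeriv c) (entropyGapDerivTwo c x) x := by
  have hx : HasDerivAt (fun x : ℝ => x) 1 x := hasDerivAt_id x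
  have h1 := Real.hasDerivAt_log hx0.ne'
  have h2 := hasDerivAt_log_one_sub hx1
  have h3 := hasDerivAt_log_one_add hx0
  have := (((hx.mul h1).const_mul (-2 * (1 - c))).add
    (((hx.const_mul (2 * c)).const_sub (1 + c)).mul h2)).add
    ((hx.const_mul 2).mul h3)
  refine this.congr_deriv ?_
  have a1 : 1 - x ≠ 0 := by linarith
  have a2 : 1 + x ≠ 0 := by linarith
  have a3 := hx0.ne'
  simp only [entropyGapDerivTwo]
  field_simp
  ring

theorem hasDerivAt_entropyGapDerivTwo (c : ℝ) {x : ℝ} (hx0 : 0 < x) (hx1 : x < 1) :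
    HasDerivAt (entropyGapDerivTwo c)
      (((1 + c) * (2 + 3 * x - x ^ 3) - 4 - 4 * x ^ 2) / (x * (1 - x) ^ 2 * (1 + x) ^ 2)) x := by
  have hx : HasDerivAt (fun x : ℝ => x) 1 x := hasDerivAt_id x
  have h1 := Real.hasDerivAt_log hx0.ne'
  have h2 := hasDerivAt_log_one_sub hx1
  have h3 := hasDerivAt_log_one_add hx0
  have a1 : 1 - x ≠ 0 := by linarith
  have a2 : 1 + x ≠ 0 := by linarith
  have := (((((h1.add_const 1).const_mul (-2 * (1 - c))).sub (h2.const_mul (2 * c))).sub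
    (((hx.const_mul (2 * c)).const_sub (1 + c)).div (hx.const_sub 1) a1)).add
    (h3.const_mul 2)).add ((hx.const_mul 2).div (hx.const_add 1) a2)
  refine this.congr_deriv ?_
  have a3 := hx0.ne'
  field_simp
  ring

theorem continuousOn_entropyGap (c : ℝ) : ContinuousOn (entropyGap c) (Set.Icc 0 1) := by
  have e : entropyGap c = fun x => -(1 - c) * x * (x * Real.log x)
      - (1 - c * x) * ((1 - x) * Real.log (1 - x)) - (1 - x ^ 2) * Real.log (1 + x) := by
    funext x
    simp only [entropyGap]
    ring
  rw [e]
  have h1 : Continuous fun x : ℝ => x * Real.log x := Real.continuous_mul_log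
  have h2 : Continuous fun x : ℝ => (1 - x) * Real.log (1 - x) :=
    h1.comp (continuous_const.sub continuous_id)
  have h3 : ContinuousOn (fun x : ℝ => Real.log (1 + x)) (Set.Icc 0 1) :=
    ContinuousOn.log (by fun_prop) (fun x hx => by linarith [hx.1])
  exact ContinuousOn.sub (by fun_prop) (ContinuousOn.mul (by fun_prop) h3)

theorem continuousOn_entropyGapDeriv (c : ℝ) {b : ℝ} (hb : b < 1) :
    ContinuousOn (entropyGapDeriv c) (Set.Icc 0 b) := by
  have h1 : Continuous fun x : ℝ => x * Real.log x := Real.continuous_mul_log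
  have h2 : ContinuousOn (fun x : ℝ => Real.log (1 - x)) (Set.Icc 0 b) :=
    ContinuousOn.log (by fun_prop) (fun x hx => by linarith [hx.2])
  have h3 : ContinuousOn (fun x : ℝ => Real.log (1 + x)) (Set.Icc 0 b) :=
    ContinuousOn.log (by fun_prop) (fun x hx => by linarith [hx.1])
  have h4 : Continuous fun x : ℝ => -2 * (1 - c) * (x * Real.log x) := h1.const_mul _
  unfold entropyGapDeriv
  exact (h4.continuousOn.add (ContinuousOn.mul (by fun_prop) h2)).add
    (ContinuousOn.mul (by fun_prop) h3)

theorem exists_entropyGapDeriv_eq_zero (c : ℝ) {a b : ℝ} (ha : 0 ≤ a) (hab : a < b) (hb : b ≤ 1)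
    (h : entropyGap c a = entropyGap c b) : ∃ d, a < d ∧ d < b ∧ entropyGapDeriv c d = 0 := by
  obtain ⟨d, hd, h0⟩ := exists_hasDerivAt_eq_zero hab
    ((continuousOn_entropyGap c).mono (Set.Icc_subset_Icc ha hb)) h
    (fun x hx => hasDerivAt_entropyGap c (ha.trans_lt hx.1) (hx.2.trans_le hb))
  exact ⟨d, hd.1, hd.2, h0⟩

theorem exists_entropyGapDerivTwo_eq_zero (c : ℝ) {a b : ℝ} (ha : 0 ≤ a) (hab : a < b) (hb : b < 1)
    (h : entropyGapDeriv c a = 0) (h' : entropyGapDeriv c b = 0) :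
    ∃ d, a < d ∧ d < b ∧ entropyGapDerivTwo c d = 0 := by
  obtain ⟨d, hd, h0⟩ := exists_hasDerivAt_eq_zero hab
    ((continuousOn_entropyGapDeriv c hb).mono (Set.Icc_subset_Icc_left ha)) (h.trans h'.symm)
    (fun x hx => hasDerivAt_entropyGapDeriv c (ha.trans_lt hx.1) (hx.2.trans hb))
  exact ⟨d, hd.1, hd.2, h0⟩

theorem exists_cubic_eq_zero (c : ℝ) {a b : ℝ} (ha : 0 < a) (hab : a < b) (hb : b < 1)
    (h : entropyGapDerivTwo c a = 0) (h' : entropyGapDerivTwo c b = 0) :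
    ∃ d, a < d ∧ d < b ∧ (1 + c) * (2 + 3 * d - d ^ 3) - 4 - 4 * d ^ 2 = 0 := by
  obtain ⟨d, hd, h0⟩ := exists_hasDerivAt_eq_zero hab
    (fun x hx => (hasDerivAt_entropyGapDerivTwo c (ha.trans_le hx.1)
      (hx.2.trans_lt hb)).continuousAt.continuousWithinAt) (h.trans h'.symm)
    (fun x hx => hasDerivAt_entropyGapDerivTwo c (ha.trans hx.1) (hx.2.trans hb))
  refine ⟨d, hd.1, hd.2, (div_eq_zero_iff.mp h0).resolve_right ?_⟩
  have a1 : 0 < 1 - d := by linarith [hd.2]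
  have a3 : 0 < d := by linarith [hd.1]
  positivity

theorem entropyGapDeriv_no_five_zeros {c : ℝ} (hc0 : 0 < c) (hc1 : c < 1) {p q r s : ℝ}
    (hp : 0 < p) (hpq : p < q) (hqr : q < r) (hrs : r < s) (hs : s < 1)
    (zp : entropyGapDeriv c p = 0) (zq : entropyGapDeriv c q = 0)
    (zr : entropyGapDeriv c r = 0) (zs : entropyGapDeriv c s = 0) : False := by
  have z0 : entropyGapDeriv c 0 = 0 := by simp [entropyGapDeriv]
  obtain ⟨e1, h1, h1', k1⟩ := exists_entropyGapDerivTwo_eq_zero c le_rfl hp (by linarith) z0 zp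
  obtain ⟨e2, h2, h2', k2⟩ := exists_entropyGapDerivTwo_eq_zero c hp.le hpq (by linarith) zp zq
  obtain ⟨e3, h3, h3', k3⟩ :=
    exists_entropyGapDerivTwo_eq_zero c (by linarith) hqr (by linarith) zq zr
  obtain ⟨e4, h4, h4', k4⟩ :=
    exists_entropyGapDerivTwo_eq_zero c (by linarith) hrs (by linarith) zr zs
  obtain ⟨u, g1, g1', l1⟩ :=
    exists_cubic_eq_zero c h1 (h1'.trans h2) (by linarith) k1 k2
  obtain ⟨v, g2, g2', l2⟩ :=
    exists_cubic_eq_zero c (by linarith) (h2'.trans h3) (by linarith) k2 k3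
  obtain ⟨w, g3, g3', l3⟩ :=
    exists_cubic_eq_zero c (by linarith) (h3'.trans h4) (by linarith) k3 k4
  exact cubic_no_three_pos_roots hc0 hc1 (h1.trans g1) (g1'.trans g2) (g2'.trans g3) l1 l2 l3

theorem exists_entropyGap_pos_near_zero {c : ℝ} (hc0 : 0 < c) (hc1 : c < 1) {a : ℝ} (ha : 0 < a)
    (ha1 : a < 1) : ∃ x, 0 < x ∧ x < a ∧ 0 < entropyGap c x := by
  set x := min (a / 2) (Real.exp (-(2 * (1 + c) / (1 - c)))) with hx
  have d : 0 < 1 - c := by linarith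
  have hx0 : 0 < x := lt_min (by linarith) (Real.exp_pos _)
  have hxa : x < a := (min_le_left _ _).trans_lt (by linarith)
  refine ⟨x, hx0, hxa, ?_⟩
  have hx1 : x < 1 := hxa.trans ha1
  have hl : Real.log x ≤ -(2 * (1 + c) / (1 - c)) := by
    rw [← Real.log_exp (-(2 * (1 + c) / (1 - c)))]
    exact Real.log_le_log hx0 (min_le_right _ _)
  have hl' : (1 - c) * Real.log x ≤ -(2 * (1 + c)) := by
    have := mul_le_mul_of_nonneg_left hl d.le
    rwa [mul_neg, mul_div_cancel₀ _ d.ne'] at this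
  have h2 : Real.log (1 - x) ≤ -x := by
    have := Real.log_le_sub_one_of_pos (show 0 < 1 - x by linarith)
    linarith
  have h3 : Real.log (1 + x) ≤ x := by
    have := Real.log_le_sub_one_of_pos (show 0 < 1 + x by linarith)
    linarith
  have hcx : 0 < 1 - c * x := by nlinarith
  have m1 := mul_le_mul_of_nonneg_left hl' (sq_nonneg x)
  have m2 := mul_le_mul_of_nonneg_left h2 (mul_nonneg (sub_nonneg.2 hx1.le) hcx.le)
  have m3 := mul_le_mul_of_nonneg_left h3 (show 0 ≤ 1 - x ^ 2 by nlinarith)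
  unfold entropyGap
  have : 0 < x ^ 2 * (1 + c) := by positivity
  have : 0 < x ^ 3 := by positivity
  have : 0 < c * x ^ 3 := by positivity
  nlinarith

theorem exists_entropyGap_pos_near_one {c : ℝ} (hc0 : 0 < c) (hc1 : c < 1) {a : ℝ} (ha : 0 < a)
    (ha1 : a < 1) : ∃ x, a < x ∧ x < 1 ∧ 0 < entropyGap c x := by
  set y := min ((1 - a) / 2) (Real.exp (-(4 / (1 - c)))) with hy
  have d : 0 < 1 - c := by linarith
  have hy0 : 0 < y := lt_min (by linarith) (Real.exp_pos _)
  have hya : y < 1 - a := (min_le_left _ _).trans_lt (by linarith)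
  refine ⟨1 - y, by linarith, by linarith, ?_⟩
  have hl : Real.log y ≤ -(4 / (1 - c)) := by
    rw [← Real.log_exp (-(4 / (1 - c)))]
    exact Real.log_le_log hy0 (min_le_right _ _)
  have hl' : (1 - c) * Real.log y ≤ -4 := by
    have := mul_le_mul_of_nonneg_left hl d.le
    rwa [mul_neg, mul_div_cancel₀ _ d.ne'] at this
  have hl0 : Real.log y ≤ 0 := Real.log_nonpos hy0.le (by linarith)
  have h2 : Real.log (1 - y) ≤ 0 := Real.log_nonpos (by linarith) (by linarith)
  have h3 : Real.log (1 + (1 - y)) ≤ 1 := by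
    have := Real.log_le_sub_one_of_pos (show 0 < 1 + (1 - y) by linarith)
    linarith
  have m1 := mul_le_mul_of_nonneg_left hl' hy0.le
  have m2 := mul_nonneg_of_nonpos_of_nonpos (show -(y * (c * y)) ≤ 0 by
    have : 0 < y * (c * y) := by positivity
    linarith) hl0
  have m3 := mul_nonneg (mul_nonneg d.le (sq_nonneg (1 - y))) (neg_nonneg.2 h2)
  have m4 := mul_le_mul_of_nonneg_left h3 (show 0 ≤ 1 - (1 - y) ^ 2 by nlinarith)
  unfold entropyGap
  rw [show 1 - (1 - y) = y by ring]
  nlinarith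

theorem log_one_sub_golden {c : ℝ} (hc : c ^ 2 = 1 - c) : Real.log (1 - c) = 2 * Real.log c := by
  rw [← hc, Real.log_pow]
  norm_num

theorem log_one_add_golden {c : ℝ} (hc : c ^ 2 = 1 - c) (hc0 : 0 < c) :
    Real.log (1 + c) = -Real.log c := by
  rw [← Real.log_inv]
  congr 1
  field_simp
  linarith

theorem entropyGap_golden {c : ℝ} (hc : c ^ 2 = 1 - c) (hc0 : 0 < c) : entropyGap c c = 0 := by
  rw [entropyGap, log_one_sub_golden hc, log_one_add_golden hc hc0]
  linear_combination (1 - c) * Real.log c * hc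

theorem entropyGapDeriv_golden {c : ℝ} (hc : c ^ 2 = 1 - c) (hc0 : 0 < c) :
    entropyGapDeriv c c = 0 := by
  rw [entropyGapDeriv, log_one_sub_golden hc, log_one_add_golden hc hc0]
  linear_combination (-2) * Real.log c * hc

theorem entropyGap_nonneg {c : ℝ} (hc : c ^ 2 = 1 - c) (hc0 : 0 < c) {a : ℝ} (ha0 : 0 ≤ a)
    (ha1 : a ≤ 1) : 0 ≤ entropyGap c a := by
  have hc1 : c < 1 := by nlinarith
  have z0 : entropyGap c 0 = 0 := by simp [entropyGap]
  have z1 : entropyGap c 1 = 0 := by simp [entropyGap]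
  have zc := entropyGap_golden hc hc0
  have zc' := entropyGapDeriv_golden hc hc0
  by_contra! hneg
  have ha0 : 0 < a := lt_of_le_of_ne ha0 (by rintro rfl; linarith)
  have ha1 : a < 1 := lt_of_le_of_ne ha1 (by rintro rfl; linarith)
  rcases lt_trichotomy a c with hac | rfl | hac
  · obtain ⟨x, hx0, hxa, hx⟩ := exists_entropyGap_pos_near_zero hc0 hc1 ha0 ha1
    obtain ⟨b, hb, zb⟩ := intermediate_value_Icc' hxa.le
      ((continuousOn_entropyGap c).mono (Set.Icc_subset_Icc hx0.le ha1.le)) ⟨hneg.le, hx.le⟩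
    have hba : b < a := lt_of_le_of_ne hb.2 (by rintro rfl; linarith)
    have hb0 : 0 < b := hx0.trans_le hb.1
    obtain ⟨p, hp, hp', zp⟩ :=
      exists_entropyGapDeriv_eq_zero c le_rfl hb0 (by linarith) (z0.trans zb.symm)
    obtain ⟨q, hq, hq', zq⟩ :=
      exists_entropyGapDeriv_eq_zero c hb0.le (hba.trans hac) hc1.le (zb.trans zc.symm)
    obtain ⟨s, hs, hs', zs⟩ :=
      exists_entropyGapDeriv_eq_zero c hc0.le hc1 le_rfl (zc.trans z1.symm)
    exact entropyGapDeriv_no_five_zeros hc0 hc1 hp (hp'.trans hq) hq' hs hs' zp zq zc' zs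
  · linarith
  · obtain ⟨x, hxa, hx1, hx⟩ := exists_entropyGap_pos_near_one hc0 hc1 ha0 ha1
    obtain ⟨b, hb, zb⟩ := intermediate_value_Icc hxa.le
      ((continuousOn_entropyGap c).mono (Set.Icc_subset_Icc ha0.le hx1.le)) ⟨hneg.le, hx.le⟩
    have hab : a < b := lt_of_le_of_ne hb.1 (by rintro rfl; linarith)
    have hb1 : b < 1 := hb.2.trans_lt hx1
    obtain ⟨p, hp, hp', zp⟩ :=
      exists_entropyGapDeriv_eq_zero c le_rfl hc0 hc1.le (z0.trans zc.symm)
    obtain ⟨r, hr, hr', zr⟩ :=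
      exists_entropyGapDeriv_eq_zero c hc0.le (hac.trans hab) hb1.le (zc.trans zb.symm)
    obtain ⟨s, hs, hs', zs⟩ :=
      exists_entropyGapDeriv_eq_zero c (by linarith) hb1 le_rfl (zb.trans z1.symm)
    exact entropyGapDeriv_no_five_zeros hc0 hc1 hp hp' hr (hr'.trans hs) hs' zp zc' zr zs

theorem entropyGap_eq {c x : ℝ} (hx0 : 0 ≤ x) (hx1 : x ≤ 1) :
    entropyGap c x = Real.binEntropy (x ^ 2) - (1 + c) * (x * Real.binEntropy x) := by
  rcases hx1.eq_or_lt with rfl | hx1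
  · simp [entropyGap]
  have : Real.log (1 - x ^ 2) = Real.log (1 - x) + Real.log (1 + x) := by
    rw [← Real.log_mul (by linarith) (by linarith)]
    ring_nf
  simp only [Real.binEntropy, Real.log_inv, entropyGap, this, Real.log_pow]
  push_cast
  ring

theorem binEntropy_sq_ge {c : ℝ} (hc : c ^ 2 = 1 - c) (hc0 : 0 < c) {x : ℝ} (hx0 : 0 ≤ x)
    (hx1 : x ≤ 1) : (1 + c) * (x * Real.binEntropy x) ≤ Real.binEntropy (x ^ 2) := by
  have := entropyGap_nonneg hc hc0 hx0 hx1
  rw [entropyGap_eq hx0 hx1] at this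
  linarith

theorem hasSum_binEntropy_div {x : ℝ} (hx0 : 0 < x) (hx1 : x < 1) :
    HasSum (fun n : ℕ => x ^ (n + 1) / ((n + 1) * (n + 2)))
      (1 - Real.log x - Real.binEntropy x / x) := by
  have h := Real.hasSum_pow_div_log_of_abs_lt_one (x := x) (by rwa [abs_of_pos hx0])
  have h' := ((hasSum_nat_add_iff' 1).mpr h).mul_left x⁻¹
  have e : (fun n : ℕ => x ^ (n + 1) / (((n : ℝ) + 1) * (n + 2))) =
      fun n : ℕ => x ^ (n + 1) / ((n : ℝ) + 1) -
        x⁻¹ * (x ^ (n + 1 + 1) / (((n + 1 : ℕ) : ℝ) + 1)) := by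
    funext n
    push_cast
    have : (n : ℝ) + 1 ≠ 0 := by positivity
    have : (n : ℝ) + 2 ≠ 0 := by positivity
    have : (n : ℝ) + 1 + 1 ≠ 0 := by positivity
    field_simp
    ring
  have e' : 1 - Real.log x - Real.binEntropy x / x = -Real.log (1 - x) -
      x⁻¹ * (-Real.log (1 - x) - ∑ i ∈ Finset.range 1, x ^ (i + 1) / ((i : ℝ) + 1)) := by
    simp only [Real.binEntropy, Real.log_inv, Finset.sum_range_one]
    push_cast
    field_simp
    ring
  rw [e, e']
  exact h.sub h'

theorem binEntropy_div_add_le {x y z : ℝ} (hx0 : 0 < x) (hx1 : x < 1) (hy0 : 0 < y) (hy1 : y < 1)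
    (hz0 : 0 < z) (hz : z ^ 2 = x * y) :
    Real.binEntropy x / x + Real.binEntropy y / y ≤ 2 * (Real.binEntropy z / z) := by
  have hz1 : z < 1 := by nlinarith
  have key := hasSum_le (fun n => ?_) ((hasSum_binEntropy_div hz0 hz1).mul_left 2)
    ((hasSum_binEntropy_div hx0 hx1).add (hasSum_binEntropy_div hy0 hy1))
  · have : 2 * Real.log z = Real.log x + Real.log y := by
      rw [← Real.log_mul hx0.ne' hy0.ne', ← hz, Real.log_pow]
      norm_num
    linarith
  · rw [← add_div, ← mul_div_assoc]
    gcongr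
    refine abs_le_of_sq_le_sq' ?_ (by positivity) |>.2
    have : (z ^ (n + 1)) ^ 2 = x ^ (n + 1) * y ^ (n + 1) := by
      rw [← mul_pow, ← hz]
      ring
    nlinarith [sq_nonneg (x ^ (n + 1) - y ^ (n + 1))]

theorem binEntropy_mul_ge {c : ℝ} (hc : c ^ 2 = 1 - c) (hc0 : 0 < c) {x y : ℝ} (hx0 : 0 ≤ x)
    (hx1 : x ≤ 1) (hy0 : 0 ≤ y) (hy1 : y ≤ 1) :
    (1 + c) / 2 * (x * Real.binEntropy y + y * Real.binEntropy x) ≤ Real.binEntropy (x * y) := by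
  have hc1 : c < 1 := by nlinarith
  have half : ∀ t, 0 ≤ t → t ≤ 1 → (1 + c) / 2 * Real.binEntropy t ≤ Real.binEntropy t := by
    intro t h0 h1
    have := Real.binEntropy_nonneg h0 h1
    nlinarith
  rcases hx0.eq_or_lt with rfl | hx0
  · simp
  rcases hy0.eq_or_lt with rfl | hy0
  · simp
  rcases hx1.eq_or_lt with rfl | hx1
  · simpa using half y hy0.le hy1
  rcases hy1.eq_or_lt with rfl | hy1
  · simpa using half x hx0.le hx1.le
  set z := Real.sqrt (x * y) with hzdef
  have hz0 : 0 < z := Real.sqrt_pos.2 (mul_pos hx0 hy0)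
  have hz : z ^ 2 = x * y := Real.sq_sqrt (mul_pos hx0 hy0).le
  have hz1 : z ≤ 1 := by nlinarith
  have h1 := binEntropy_div_add_le hx0 hx1 hy0 hy1 hz0 hz
  have h2 := binEntropy_sq_ge hc hc0 hz0.le hz1
  have h3 := mul_le_mul_of_nonneg_left h1 (mul_pos hx0 hy0).le
  have e1 : x * y * (Real.binEntropy x / x + Real.binEntropy y / y)
      = x * Real.binEntropy y + y * Real.binEntropy x := by
    field_simp
    ring
  have e2 : x * y * (2 * (Real.binEntropy z / z)) = 2 * (z * Real.binEntropy z) := by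
    rw [← hz]
    field_simp
  rw [e1, e2] at h3
  rw [hz] at h2
  nlinarith

theorem negMulLog_le_tangent {a b : ℝ} (ha : 0 ≤ a) (hb : 0 < b) :
    Real.negMulLog a ≤ -a * Real.log b + b - a := by
  rcases ha.eq_or_lt with rfl | ha
  · simpa using hb.le
  have h := Real.log_le_sub_one_of_pos (div_pos hb ha)
  rw [Real.log_div hb.ne' ha.ne'] at h
  have h' := mul_le_mul_of_nonneg_left h ha.le
  have e : a * (b / a - 1) = b - a := by field_simp
  rw [e] at h'
  rw [Real.negMulLog]
  linarith

/-- The unnormalised entropy gained by splitting a mass `u + v` into the two parts `u` and `v`. -/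
noncomputable def binSplit (u v : ℝ) : ℝ :=
  Real.negMulLog u + Real.negMulLog v - Real.negMulLog (u + v)

theorem binSplit_zero_left (v : ℝ) : binSplit 0 v = 0 := by simp [binSplit]

theorem binSplit_zero_right (u : ℝ) : binSplit u 0 = 0 := by simp [binSplit]

theorem binSplit_eq_mul_binEntropy {u v : ℝ} (h : u + v ≠ 0) :
    binSplit u v = (u + v) * Real.binEntropy (u / (u + v)) := by
  have e : 1 - u / (u + v) = v / (u + v) := by
    field_simp
    ring
  rw [Real.binEntropy_eq_negMulLog_add_negMulLog_one_sub, e, binSplit]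
  simp only [Real.negMulLog]
  rcases eq_or_ne u 0 with rfl | hu
  · rcases eq_or_ne v 0 with rfl | hv
    · simp
    · simp [hv]
  rcases eq_or_ne v 0 with rfl | hv
  · simp [hu]
  rw [Real.log_div hu h, Real.log_div hv h]
  field_simp
  ring

theorem binSplit_nonneg {u v : ℝ} (hu : 0 ≤ u) (hv : 0 ≤ v) : 0 ≤ binSplit u v := by
  rcases eq_or_ne (u + v) 0 with h | h
  · have : u = 0 := by linarith
    rw [this, binSplit_zero_left]
  rw [binSplit_eq_mul_binEntropy h]
  have h' : 0 < u + v := lt_of_le_of_ne (by linarith) h.symm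
  exact mul_nonneg h'.le (Real.binEntropy_nonneg (by positivity)
    ((div_le_one h').2 (by linarith)))

theorem binSplit_le_cross {u v p q : ℝ} (hu : 0 ≤ u) (hv : 0 ≤ v) (hp : 0 < p) (hq : 0 < q)
    (hpq : p + q = 1) : binSplit u v ≤ -u * Real.log p - v * Real.log q := by
  rcases eq_or_ne (u + v) 0 with h | h
  · have h1 : u = 0 := by linarith
    have h2 : v = 0 := by linarith
    simp [h1, h2, binSplit_zero_left]
  have h' : 0 < u + v := lt_of_le_of_ne (by linarith) h.symm
  have h1 := negMulLog_le_tangent hu (mul_pos hp h')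
  have h2 := negMulLog_le_tangent hv (mul_pos hq h')
  rw [Real.log_mul hp.ne' h] at h1
  rw [Real.log_mul hq.ne' h] at h2
  have h3 : p * (u + v) + q * (u + v) = u + v := by rw [← add_mul, hpq, one_mul]
  have h4 : Real.negMulLog (u + v) = -(u + v) * Real.log (u + v) := rfl
  rw [binSplit, h4]
  linarith

theorem sum_binSplit_le {ι : Type*} (s : Finset ι) (u v : ι → ℝ) (hu : ∀ j ∈ s, 0 ≤ u j)
    (hv : ∀ j ∈ s, 0 ≤ v j) :
    ∑ j ∈ s, binSplit (u j) (v j) ≤ binSplit (∑ j ∈ s, u j) (∑ j ∈ s, v j) := by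
  rcases (Finset.sum_nonneg hu).eq_or_lt with h0 | hU
  · rw [← h0, binSplit_zero_left]
    refine (Finset.sum_eq_zero fun j hj => ?_).le
    rw [(Finset.sum_eq_zero_iff_of_nonneg hu).1 h0.symm j hj, binSplit_zero_left]
  rcases (Finset.sum_nonneg hv).eq_or_lt with h0 | hV
  · rw [← h0, binSplit_zero_right]
    refine (Finset.sum_eq_zero fun j hj => ?_).le
    rw [(Finset.sum_eq_zero_iff_of_nonneg hv).1 h0.symm j hj, binSplit_zero_right]
  set U := ∑ j ∈ s, u j
  set V := ∑ j ∈ s, v j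
  have hW : 0 < U + V := by linarith
  calc ∑ j ∈ s, binSplit (u j) (v j)
      ≤ ∑ j ∈ s, (-u j * Real.log (U / (U + V)) - v j * Real.log (V / (U + V))) :=
        Finset.sum_le_sum fun j hj => binSplit_le_cross (hu j hj) (hv j hj) (div_pos hU hW)
          (div_pos hV hW) (by field_simp)
    _ = -U * Real.log (U / (U + V)) - V * Real.log (V / (U + V)) := by
        rw [Finset.sum_sub_distrib, ← Finset.sum_mul, ← Finset.sum_mul, Finset.sum_neg_distrib]
    _ = binSplit U V := by
        rw [Real.log_div hU.ne' hW.ne', Real.log_div hV.ne' hW.ne']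
        simp only [binSplit, Real.negMulLog]
        ring

theorem binSplit_mul_ge {c : ℝ} (hc : c ^ 2 = 1 - c) (hc0 : 0 < c) {u v u' v' : ℝ} (hu : 0 ≤ u)
    (hv : 0 ≤ v) (hu' : 0 ≤ u') (hv' : 0 ≤ v') :
    (1 + c) / 2 * (u * binSplit u' v' + u' * binSplit u v) ≤
      binSplit (u * u') ((u + v) * (u' + v') - u * u') := by
  rcases eq_or_ne (u + v) 0 with h | h
  · have h1 : u = 0 := by linarith
    have h2 : v = 0 := by linarith
    simp [h1, h2, binSplit_zero_left]
  rcases eq_or_ne (u' + v') 0 with h' | h'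
  · have h1 : u' = 0 := by linarith
    have h2 : v' = 0 := by linarith
    simp [h1, h2, binSplit_zero_left]
  have hw : 0 < u + v := lt_of_le_of_ne (by linarith) h.symm
  have hw' : 0 < u' + v' := lt_of_le_of_ne (by linarith) h'.symm
  have e : u * u' + ((u + v) * (u' + v') - u * u') = (u + v) * (u' + v') := by ring
  rw [binSplit_eq_mul_binEntropy h, binSplit_eq_mul_binEntropy h',
    binSplit_eq_mul_binEntropy (by rw [e]; positivity), e, mul_div_mul_comm]
  have key := binEntropy_mul_ge hc hc0 (x := u / (u + v)) (y := u' / (u' + v')) (by positivity)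
    ((div_le_one hw).2 (by linarith)) (by positivity) ((div_le_one hw').2 (by linarith))
  refine le_of_eq_of_le ?_ (mul_le_mul_of_nonneg_left key (mul_pos hw hw').le)
  field_simp

section Fibers

variable {α ι : Type*} [DecidableEq α]

/-- The number of indices whose set has trace `T` on `S` and omits `i`. -/
noncomputable def missCount (s : Finset ι) (X : ι → Finset α) (S : Finset α) (i : α)
    (T : Finset α) : ℝ :=
  (s.filter fun j => X j ∩ S = T ∧ i ∉ X j).card

/-- The number of indices whose set has trace `T` on `S` and contains `i`. -/
noncomputable def hitCount (s : Finset ι) (X : ι → Finset α) (S : Finset α) (i : α)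
    (T : Finset α) : ℝ :=
  (s.filter fun j => X j ∩ S = T ∧ i ∈ X j).card

/-- The unnormalised entropy (up to an additive constant) of the trace of `X` on `S`. -/
noncomputable def traceEntropy (s : Finset ι) (X : ι → Finset α) (S : Finset α) : ℝ :=
  ∑ T ∈ S.powerset, Real.negMulLog (s.filter fun j => X j ∩ S = T).card

theorem missCount_add_hitCount (s : Finset ι) (X : ι → Finset α) (S : Finset α) (i : α)
    (T : Finset α) :
    missCount s X S i T + hitCount s X S i T = (s.filter fun j => X j ∩ S = T).card := by
  rw [missCount, hitCount, add_comm, ← Finset.filter_filter, ← Finset.filter_filter]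
  exact_mod_cast Finset.card_filter_add_card_filter_not (s := s.filter fun j => X j ∩ S = T)
    (fun j => i ∈ X j)

theorem traceEntropy_insert (s : Finset ι) (X : ι → Finset α) {S : Finset α} {i : α}
    (hi : i ∉ S) :
    traceEntropy s X (insert i S) = traceEntropy s X S +
      ∑ T ∈ S.powerset, binSplit (missCount s X S i T) (hitCount s X S i T) := by
  rw [traceEntropy, traceEntropy, Finset.sum_powerset_insert hi, ← Finset.sum_add_distrib,
    ← Finset.sum_add_distrib]
  refine Finset.sum_congr rfl fun T hT => ?_
  have hiT : i ∉ T := fun h => hi (Finset.mem_powerset.1 hT h)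
  have e1 : ((s.filter fun j => X j ∩ insert i S = T).card : ℝ) = missCount s X S i T := by
    rw [missCount]
    congr 2
    ext j
    simp only [Finset.mem_filter]
    refine and_congr_right fun _ => ⟨?_, ?_⟩
    · rintro h
      have : i ∉ X j := fun h' => hiT (by rw [← h]; simp [h'])
      refine ⟨?_, this⟩
      rwa [Finset.inter_insert_of_notMem this] at h
    · rintro ⟨h, h'⟩
      rwa [Finset.inter_insert_of_notMem h']
  have e2 : ((s.filter fun j => X j ∩ insert i S = insert i T).card : ℝ) =
      hitCount s X S i T := by
    rw [hitCount]
    congr 2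
    ext j
    simp only [Finset.mem_filter]
    refine and_congr_right fun _ => ⟨?_, ?_⟩
    · rintro h
      have hm : i ∈ X j := by
        have : i ∈ X j ∩ insert i S := by rw [h]; simp
        exact (Finset.mem_inter.1 this).1
      refine ⟨?_, hm⟩
      rw [Finset.inter_insert_of_mem hm] at h
      have := congrArg (fun Z => Finset.erase Z i) h
      simpa [Finset.erase_insert, hi, hiT] using this
    · rintro ⟨h, h'⟩
      rw [Finset.inter_insert_of_mem h', h]
  rw [e1, e2, binSplit, missCount_add_hitCount]
  ring

theorem traceEntropy_empty (s : Finset ι) (X : ι → Finset α) :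
    traceEntropy s X ∅ = Real.negMulLog s.card := by
  simp [traceEntropy]

theorem sum_missCount (s : Finset ι) (X : ι → Finset α) (S : Finset α) (i : α) :
    ∑ T ∈ S.powerset, missCount s X S i T = (s.filter fun j => i ∉ X j).card := by
  have := Finset.card_eq_sum_card_fiberwise (s := s.filter fun j => i ∉ X j)
    (t := S.powerset) (f := fun j => X j ∩ S) (fun j _ => by simp)
  rw [this]
  push_cast
  refine Finset.sum_congr rfl fun T _ => ?_
  rw [missCount, Finset.filter_filter]
  congr 3
  ext j
  exact and_comm

variable (F : Finset (Finset α)) (S : Finset α) (i : α) (T : Finset α)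

theorem missCount_union :
    missCount (F ×ˢ F) (fun p => p.1 ∪ p.2) S i T =
      ∑ t ∈ (S.powerset ×ˢ S.powerset).filter fun t => t.1 ∪ t.2 = T,
        missCount F id S i t.1 * missCount F id S i t.2 := by
  rw [missCount, Finset.card_eq_sum_card_fiberwise (f := fun p => (p.1 ∩ S, p.2 ∩ S))
    (t := (S.powerset ×ˢ S.powerset).filter fun t => t.1 ∪ t.2 = T)]
  · push_cast
    refine Finset.sum_congr rfl fun t ht => ?_
    have ht' := (Finset.mem_filter.1 ht).2
    rw [missCount, missCount, ← Nat.cast_mul, ← Finset.card_product]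
    congr 2
    ext p
    simp only [Finset.mem_filter, Finset.mem_product, Finset.union_inter_distrib_right,
      Finset.mem_union, Prod.ext_iff, id]
    constructor
    · rintro ⟨⟨⟨h1, h2⟩, -, h3⟩, h4, h5⟩
      tauto
    · rintro ⟨⟨h1, h2, h3⟩, h4, h5, h6⟩
      rw [h2, h5]
      tauto
  · intro p hp
    have := (Finset.mem_filter.1 hp).2.1
    simp only [Finset.coe_filter, Finset.mem_product, Finset.mem_powerset, Set.mem_ofPred_eq]
    exact ⟨⟨Finset.inter_subset_right, Finset.inter_subset_right⟩, by
      rw [← Finset.union_inter_distrib_right, this]⟩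

theorem missCount_add_hitCount_union :
    missCount (F ×ˢ F) (fun p => p.1 ∪ p.2) S i T + hitCount (F ×ˢ F) (fun p => p.1 ∪ p.2) S i T =
      ∑ t ∈ (S.powerset ×ˢ S.powerset).filter fun t => t.1 ∪ t.2 = T,
        (missCount F id S i t.1 + hitCount F id S i t.1) *
          (missCount F id S i t.2 + hitCount F id S i t.2) := by
  simp only [missCount_add_hitCount]
  rw [Finset.card_eq_sum_card_fiberwise (f := fun p => (p.1 ∩ S, p.2 ∩ S))
    (t := (S.powerset ×ˢ S.powerset).filter fun t => t.1 ∪ t.2 = T)]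
  · push_cast
    refine Finset.sum_congr rfl fun t ht => ?_
    have ht' := (Finset.mem_filter.1 ht).2
    rw [← Nat.cast_mul, ← Finset.card_product]
    congr 2
    ext p
    simp only [Finset.mem_filter, Finset.mem_product, Finset.union_inter_distrib_right,
      Prod.ext_iff, id]
    constructor
    · rintro ⟨⟨⟨h1, h2⟩, h3⟩, h4, h5⟩
      tauto
    · rintro ⟨⟨h1, h2⟩, h4, h5⟩
      rw [h2, h5]
      tauto
  · intro p hp
    have := (Finset.mem_filter.1 hp).2
    simp only [Finset.coe_filter, Finset.mem_product, Finset.mem_powerset, Set.mem_ofPred_eq]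
    exact ⟨⟨Finset.inter_subset_right, Finset.inter_subset_right⟩, by
      rw [← Finset.union_inter_distrib_right, this]⟩

theorem missCount_nonneg (s : Finset ι) (X : ι → Finset α) : 0 ≤ missCount s X S i T :=
  Nat.cast_nonneg _

theorem hitCount_nonneg (s : Finset ι) (X : ι → Finset α) : 0 ≤ hitCount s X S i T :=
  Nat.cast_nonneg _

theorem sum_binSplit_union_ge {c : ℝ} (hc : c ^ 2 = 1 - c) (hc0 : 0 < c) :
    (1 + c) * (F.filter fun A => i ∉ A).card *
        ∑ T ∈ S.powerset, binSplit (missCount F id S i T) (hitCount F id S i T) ≤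
      ∑ T ∈ S.powerset, binSplit (missCount (F ×ˢ F) (fun p => p.1 ∪ p.2) S i T)
        (hitCount (F ×ˢ F) (fun p => p.1 ∪ p.2) S i T) := by
  set o := missCount F id S i with ho
  set h := hitCount F id S i with hh
  have ho0 : ∀ T, 0 ≤ o T := fun T => missCount_nonneg S i T F id
  have hh0 : ∀ T, 0 ≤ h T := fun T => hitCount_nonneg S i T F id
  have hs : ((F.filter fun A => i ∉ A).card : ℝ) = ∑ T ∈ S.powerset, o T :=
    (sum_missCount F id S i).symm
  have hit : ∀ T, hitCount (F ×ˢ F) (fun p => p.1 ∪ p.2) S i T =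
      ∑ t ∈ (S.powerset ×ˢ S.powerset).filter fun t => t.1 ∪ t.2 = T,
        ((o t.1 + h t.1) * (o t.2 + h t.2) - o t.1 * o t.2) := by
    intro T
    rw [Finset.sum_sub_distrib, ← missCount_union, ← missCount_add_hitCount_union]
    ring
  calc _ = ∑ t ∈ S.powerset ×ˢ S.powerset, (1 + c) / 2 *
          (o t.1 * binSplit (o t.2) (h t.2) + o t.2 * binSplit (o t.1) (h t.1)) := by
        rw [← Finset.mul_sum, Finset.sum_add_distrib, Finset.sum_product,
          Finset.sum_product_right]
        simp only
        rw [← Finset.sum_mul_sum, hs]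
        ring
    _ ≤ ∑ t ∈ S.powerset ×ˢ S.powerset,
          binSplit (o t.1 * o t.2) ((o t.1 + h t.1) * (o t.2 + h t.2) - o t.1 * o t.2) :=
        Finset.sum_le_sum fun t _ => binSplit_mul_ge hc hc0 (ho0 _) (hh0 _) (ho0 _) (hh0 _)
    _ = ∑ T ∈ S.powerset, ∑ t ∈ (S.powerset ×ˢ S.powerset).filter fun t => t.1 ∪ t.2 = T,
          binSplit (o t.1 * o t.2) ((o t.1 + h t.1) * (o t.2 + h t.2) - o t.1 * o t.2) := by
        refine (Finset.sum_fiberwise_of_maps_to (fun t ht => ?_) _).symm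
        simp only [Finset.mem_product, Finset.mem_powerset] at ht ⊢
        exact Finset.union_subset ht.1 ht.2
    _ ≤ _ := by
        refine Finset.sum_le_sum fun T _ => ?_
        rw [hit, missCount_union]
        refine sum_binSplit_le _ _ _ (fun t _ => mul_nonneg (ho0 _) (ho0 _)) fun t _ => ?_
        have h1 := mul_nonneg (ho0 t.1) (hh0 t.2)
        have h2 := mul_nonneg (hh0 t.1) (ho0 t.2)
        have h3 := mul_nonneg (hh0 t.1) (hh0 t.2)
        linarith

theorem traceEntropy_union_ge {c : ℝ} (hc : c ^ 2 = 1 - c) (hc0 : 0 < c) {K : ℝ}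
    (hK : ∀ i, K ≤ (1 + c) * (F.filter fun A => i ∉ A).card) :
    K * (traceEntropy F id S - Real.negMulLog F.card) ≤
      traceEntropy (F ×ˢ F) (fun p => p.1 ∪ p.2) S - Real.negMulLog (F ×ˢ F).card := by
  induction S using Finset.induction_on with
  | empty => simp [traceEntropy_empty]
  | insert i S hi ih =>
    rw [traceEntropy_insert _ _ hi, traceEntropy_insert _ _ hi]
    have h1 := sum_binSplit_union_ge F S i hc hc0
    have h2 := mul_le_mul_of_nonneg_right (hK i) (Finset.sum_nonneg fun T (_ : T ∈ S.powerset) =>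
      binSplit_nonneg (missCount_nonneg S i T F id) (hitCount_nonneg S i T F id))
    linarith

theorem inter_sup_of_mem {A : Finset α} (hA : A ∈ F) : A ∩ F.sup id = A :=
  Finset.inter_eq_left.2 (Finset.le_sup (f := id) hA)

theorem traceEntropy_sup : traceEntropy F id (F.sup id) = 0 := by
  refine Finset.sum_eq_zero fun T _ => ?_
  have : (F.filter fun A => id A ∩ F.sup id = T).card ≤ 1 := by
    refine Finset.card_le_one.2 fun A hA B hB => ?_
    rw [Finset.mem_filter] at hA hB
    rw [← inter_sup_of_mem F hA.1, ← inter_sup_of_mem F hB.1]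
    exact hA.2.trans hB.2.symm
  interval_cases h : (F.filter fun A => id A ∩ F.sup id = T).card <;> simp

theorem traceEntropy_union_sup_le (hF : F.Nonempty)
    (hM : 0 < ((F ×ˢ F).filter fun p => p.1 ∪ p.2 ∈ F).card) :
    traceEntropy (F ×ˢ F) (fun p => p.1 ∪ p.2) (F.sup id) ≤
      -(((F ×ˢ F).filter fun p => p.1 ∪ p.2 ∈ F).card : ℝ) *
        Real.log ((((F ×ˢ F).filter fun p => p.1 ∪ p.2 ∈ F).card : ℝ) / F.card) := by
  set M := ((F ×ˢ F).filter fun p => p.1 ∪ p.2 ∈ F).card with hMdef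
  have hN : (0 : ℝ) < F.card := by exact_mod_cast hF.card_pos
  have hM' : (0 : ℝ) < M := by exact_mod_cast hM
  set w : Finset α → ℕ := fun T =>
    ((F ×ˢ F).filter fun p => (p.1 ∪ p.2) ∩ F.sup id = T).card with hw
  have hsub : F ⊆ (F.sup id).powerset := fun A hA =>
    Finset.mem_powerset.2 (Finset.le_sup (f := id) hA)
  have hnonpos : ∀ n : ℕ, Real.negMulLog n ≤ 0 := by
    intro n
    rw [Real.negMulLog]
    have := mul_nonneg n.cast_nonneg (Real.log_natCast_nonneg n)
    linarith
  have hsum : ∑ T ∈ F, (w T : ℝ) = M := by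
    rw [hMdef, Finset.card_eq_sum_card_fiberwise
      (s := (F ×ˢ F).filter fun p => p.1 ∪ p.2 ∈ F) (f := fun p => p.1 ∪ p.2) (t := F)
      (fun p hp => (Finset.mem_filter.1 (Finset.mem_coe.1 hp)).2)]
    push_cast
    refine Finset.sum_congr rfl fun T hT => ?_
    simp only [hw]
    congr 2
    ext p
    simp only [Finset.mem_filter, Finset.mem_product]
    constructor
    · rintro ⟨⟨h1, h2⟩, h3⟩
      rw [Finset.union_inter_distrib_right, inter_sup_of_mem F h1, inter_sup_of_mem F h2] at h3
      exact ⟨⟨⟨h1, h2⟩, h3 ▸ hT⟩, h3⟩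
    · rintro ⟨⟨h1, h2⟩, h3⟩
      exact ⟨h1, h3 ▸ inter_sup_of_mem F h2⟩
  calc traceEntropy (F ×ˢ F) (fun p => p.1 ∪ p.2) (F.sup id)
      ≤ ∑ T ∈ F, Real.negMulLog (w T) := by
        rw [traceEntropy, ← Finset.sum_sdiff hsub]
        have := Finset.sum_nonpos fun T (_ : T ∈ (F.sup id).powerset \ F) => hnonpos (w T)
        simp only [hw] at this ⊢
        linarith
    _ ≤ ∑ T ∈ F, (-(w T : ℝ) * Real.log (M / F.card) + M / F.card - w T) :=
        Finset.sum_le_sum fun T _ => negMulLog_le_tangent (Nat.cast_nonneg _) (div_pos hM' hN)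
    _ = _ := by
        rw [Finset.sum_sub_distrib, Finset.sum_add_distrib, ← Finset.sum_mul,
          Finset.sum_neg_distrib, hsum, Finset.sum_const, nsmul_eq_mul]
        field_simp
        ring

end Fibers

/-- In any `(1-ε)`-approximate union closed family `F` with `|F| ≥ 2` (where `0 < ε < 1/2`),
some element belongs to at least a `ψ - δ` fraction of the sets, where `ψ = (3 - √5)/2` and
`δ = 2ε (1 + log₂(1/ε) / log₂ |F|)`. -/
theorem approx_union_closed_freq {α : Type*} [DecidableEq α]
    (ε : ℝ) (hε0 : 0 < ε) (hε : ε < 1 / 2)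
    (F : Finset (Finset α)) (hF : 2 ≤ F.card)
    (hUC : ApproxUnionClosed F (1 - ε)) :
    ∃ x : α, ((F.filter fun A => x ∈ A).card : ℝ) ≥
      ((3 - Real.sqrt 5) / 2 -
        2 * ε * (1 + Real.logb 2 (1 / ε) / Real.logb 2 (F.card : ℝ))) * (F.card : ℝ) := by
  by_contra! hcon
  set N : ℝ := (F.card : ℝ) with hN
  have hN2 : (2 : ℝ) ≤ N := by rw [hN]; exact_mod_cast hF
  have hN0 : 0 < N := by linarith
  set L := Real.log N with hL
  have hL0 : 0 < L := Real.log_pos (by linarith)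
  set δ := 2 * ε * (1 + Real.logb 2 (1 / ε) / Real.logb 2 N) with hδ
  set c : ℝ := (Real.sqrt 5 - 1) / 2 with hcdef
  have h5 : Real.sqrt 5 ^ 2 = 5 := Real.sq_sqrt (by norm_num)
  have h5' : (2 : ℝ) < Real.sqrt 5 := Real.lt_sqrt_of_sq_lt (by norm_num)
  have hc : c ^ 2 = 1 - c := by
    rw [hcdef]
    linear_combination h5 / 4
  have hc2 : 1 / 2 < c := by linarith
  have hc0 : 0 < c := by linarith
  have hδL : δ * L = 2 * ε * (L + Real.log (1 / ε)) := by
    rw [hδ, Real.logb, Real.logb, div_div_div_cancel_right₀ (Real.log_pos one_lt_two).ne',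
      ← hL]
    field_simp
  have hlog : 0.69 ≤ Real.log (1 / ε) := by
    have h1 : Real.log 2 ≤ Real.log (1 / ε) :=
      Real.log_le_log two_pos ((le_div_iff₀ hε0).2 (by linarith))
    have := Real.log_two_gt_d9
    linarith
  have hK : ∀ i, (1 + c) * ((c + δ) * N) ≤ (1 + c) * (F.filter fun A => i ∉ A).card := by
    intro i
    refine mul_le_mul_of_nonneg_left ?_ (by linarith)
    have h1 := hcon i
    have h2 : ((F.filter fun A => i ∈ A).card : ℝ) + (F.filter fun A => i ∉ A).card = N := by
      rw [hN]
      exact_mod_cast Finset.card_filter_add_card_filter_not (s := F) (fun A => i ∈ A)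
    have h3 : (3 - Real.sqrt 5) / 2 = 1 - c := by rw [hcdef]; ring
    rw [h3] at h1
    linarith
  have lower := traceEntropy_union_ge F (F.sup id) hc hc0 hK
  set M : ℝ := (((F ×ˢ F).filter fun p => p.1 ∪ p.2 ∈ F).card : ℝ) with hM
  have hUC' : (1 - ε) * (N * N) ≤ M := hUC
  have hM0 : 0 < M := lt_of_lt_of_le (mul_pos (by linarith) (mul_pos hN0 hN0)) hUC'
  have upper := traceEntropy_union_sup_le F (Finset.card_pos.1 (by omega))
    (by rw [hM] at hM0; exact_mod_cast hM0)
  rw [traceEntropy_sup, ← hN, Finset.card_product, Nat.cast_mul, ← hN] at lower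
  rw [← hM, ← hN] at upper
  have hNN : 0 < N * N := mul_pos hN0 hN0
  obtain ⟨m, hm⟩ : ∃ m, M = m * (N * N) := ⟨M / (N * N), by field_simp⟩
  rw [hm] at upper hM0 hUC'
  have hm0 : 0 < m := pos_of_mul_pos_left hM0 hNN.le
  have hmε : 1 - ε ≤ m := le_of_mul_le_mul_right hUC' hNN
  have elog : Real.log (m * (N * N) / N) = Real.log m + L := by
    rw [← mul_assoc, mul_div_cancel_right₀ _ hN0.ne', Real.log_mul hm0.ne' hN0.ne']
  rw [elog] at upper
  simp only [Real.negMulLog] at lower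
  rw [Real.log_mul hN0.ne' hN0.ne', ← hL] at lower
  have hmlog : -m * Real.log m ≤ ε := by
    have h1 := mul_le_mul_of_nonneg_left (Real.one_sub_inv_le_log_of_pos hm0) hm0.le
    rw [mul_sub, mul_inv_cancel₀ hm0.ne'] at h1
    linarith
  have hmL : -m * L ≤ -(1 - ε) * L := mul_le_mul_of_nonneg_right (by linarith) hL0.le
  have main : N * N * ((1 + c) * (c + δ) * L) ≤ N * N * (-m * Real.log m - m * L + 2 * L) := by
    linarith
  have main' := le_of_mul_le_mul_left main hNN
  have e1 : (1 + c) * (c + δ) * L = L + (1 + c) * (δ * L) := by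
    linear_combination L * hc
  rw [e1, hδL] at main'
  have h1 : 3 * (ε * (L + 0.69)) ≤ (1 + c) * (2 * ε * (L + Real.log (1 / ε))) := by
    have h2 : ε * (L + 0.69) ≤ ε * (L + Real.log (1 / ε)) :=
      mul_le_mul_of_nonneg_left (by linarith) hε0.le
    have h3 : 0 ≤ ε * (L + 0.69) := by positivity
    nlinarith
  have : 0 < ε * L := mul_pos hε0 hL0
  linarith
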